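/- arXiv:2106.07880 — 2 statements merged into one kernel-verified Lean document; each statement's English description precedes it below -/
import Mathlib

section
/- Let L ≥ 0 be an integer and let y, z ∈ ℝ^d be nonzero vectors. Define the dynamic-programming NTK with ReLU activation as follows: Σ^(0)(y,z) := ⟨y,z⟩; for h ≥ 1 let Λ^(h)(y,z) be the 2×2 matrix with rows (Σ^(h−1)(y,y), Σ^(h−1)(y,z)) and (Σ^(h−1)(z,y), Σ^(h−1)(z,z)) (which is positive semidefinite), and set Σ^(h)(y,z) := 2·E_{(u,v)∼N(0,Λ^(h)(y,z))}[ReLU(u)·ReLU(v)] and Σ̇^(h)(y,z) := 2·E_{(u,v)∼N(0,Λ^(h)(y,z))}[Step(u)·Step(v)]; finally Θ^(0)(y,z) := Σ^(0)(y,z) and Θ^(h)(y,z) := Θ^(h−1)(y,z)·Σ̇^(h)(y,z) + Σ^(h)(y,z). Then Θ^(L)(y,z) = ‖y‖₂·‖z‖₂·K_relu^(L)(⟨y,z⟩/(‖y‖₂‖z‖₂)). -/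
open MeasureTheory ProbabilityTheory
open scoped Classical

noncomputable def kappa0 (α : ℝ) : ℝ := (1 / Real.pi) * (Real.pi - Real.arccos α)

noncomputable def kappa1 (α : ℝ) : ℝ :=
  (1 / Real.pi) * (Real.sqrt (1 - α ^ 2) + α * (Real.pi - Real.arccos α))

/-- `Σ_relu^(ℓ)` -/
noncomputable def SigmaRelu : ℕ → ℝ → ℝ
  | 0, α => α
  | n + 1, α => kappa1 (SigmaRelu n α)

/-- `Σ̇_relu^(ℓ) = κ0 (Σ_relu^(ℓ-1))`, meaningful for `ℓ ≥ 1`. -/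
noncomputable def SigmaDotRelu (ℓ : ℕ) (α : ℝ) : ℝ := kappa0 (SigmaRelu (ℓ - 1) α)

/-- the ReLU-NTK function `K_relu^(ℓ)` -/
noncomputable def KRelu : ℕ → ℝ → ℝ
  | 0, α => α
  | n + 1, α => KRelu n α * SigmaDotRelu (n + 1) α + SigmaRelu (n + 1) α

noncomputable def relu (t : ℝ) : ℝ := max t 0

noncomputable def step (t : ℝ) : ℝ := if 0 < t then 1 else 0

/-- The positive semidefinite square root of a positive semidefinite matrix
(Mathlib's former `Matrix.PosSemidef.sqrt`, with its old definition, over `ℝ`). -/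
noncomputable def Matrix.PosSemidef.sqrt {n : Type*} [Fintype n] [DecidableEq n]
    {A : Matrix n n ℝ} (hA : A.PosSemidef) : Matrix n n ℝ :=
  hA.1.eigenvectorUnitary.1 * Matrix.diagonal (Real.sqrt ∘ hA.1.eigenvalues) *
    (star hA.1.eigenvectorUnitary : Matrix n n ℝ)

/-- square root of a PSD matrix (junk value `0` if the matrix is not PSD). -/
noncomputable def psdSqrt (Λ : Matrix (Fin 2) (Fin 2) ℝ) : Matrix (Fin 2) (Fin 2) ℝ :=
  if h : Λ.PosSemidef then h.sqrt else 0

/-- The centered Gaussian measure on `ℝ²` with (positive semidefinite) covariance matrix `Λ`,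
realized as pushforward of the standard Gaussian under multiplication by `√Λ`. -/
noncomputable def gaussian2 (Λ : Matrix (Fin 2) (Fin 2) ℝ) : Measure (Fin 2 → ℝ) :=
  (Measure.pi fun _ : Fin 2 => gaussianReal 0 1).map fun w => (psdSqrt Λ).mulVec w

/-- the 2×2 covariance matrix `Λ^(h)(y,z)` built out of `Σ^(h-1)`. -/
noncomputable def LambdaMat {d : ℕ}
    (f : EuclideanSpace ℝ (Fin d) → EuclideanSpace ℝ (Fin d) → ℝ)
    (y z : EuclideanSpace ℝ (Fin d)) : Matrix (Fin 2) (Fin 2) ℝ :=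
  !![f y y, f y z; f z y, f z z]

/-- The dynamic-programming covariance `Σ^(h)(y,z)` of the ReLU network. -/
noncomputable def SigmaDP (d : ℕ) :
    ℕ → EuclideanSpace ℝ (Fin d) → EuclideanSpace ℝ (Fin d) → ℝ
  | 0 => fun y z => (inner ℝ y z : ℝ)
  | h + 1 => fun y z =>
      2 * ∫ w, relu (w 0) * relu (w 1) ∂(gaussian2 (LambdaMat (SigmaDP d h) y z))

/-- The dynamic-programming derivative covariance `Σ̇^(h)(y,z)`, meaningful for `h ≥ 1`. -/
noncomputable def SigmaDotDP (d : ℕ) (h : ℕ)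
    (y z : EuclideanSpace ℝ (Fin d)) : ℝ :=
  2 * ∫ w, step (w 0) * step (w 1) ∂(gaussian2 (LambdaMat (SigmaDP d (h - 1)) y z))

/-- The dynamic-programming NTK `Θ^(h)(y,z)` of the ReLU network. -/
noncomputable def ThetaDP (d : ℕ) :
    ℕ → EuclideanSpace ℝ (Fin d) → EuclideanSpace ℝ (Fin d) → ℝ
  | 0 => SigmaDP d 0
  | h + 1 => fun y z => ThetaDP d h y z * SigmaDotDP d (h + 1) y z + SigmaDP d (h + 1) y z


/-- the common generalization of `step` (`m = 0`) and `relu` (`m = 1`). -/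
noncomputable def rsFun (m : ℕ) (t : ℝ) : ℝ := step t * t ^ m

lemma step_eq_rsFun (t : ℝ) : step t = rsFun 0 t := by simp [rsFun]

lemma relu_eq_rsFun (t : ℝ) : relu t = rsFun 1 t := by
  unfold rsFun relu step
  split_ifs with h
  · simp [h.le]
  · simp [not_lt.mp h]

lemma measurable_rsFun (m : ℕ) : Measurable (rsFun m) := by
  unfold rsFun step
  refine Measurable.mul ?_ (by fun_prop)
  exact Measurable.ite measurableSet_Ioi measurable_const measurable_const

lemma rsFun_mul (m : ℕ) {c : ℝ} (hc : 0 < c) (t : ℝ) : rsFun m (c * t) = c ^ m * rsFun m t := by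
  unfold rsFun step
  simp only [mul_pos_iff_of_pos_left hc, mul_pow]
  ring

lemma gauss_polar (f : ℝ × ℝ → ℝ) :
    ∫ p, f p ∂((gaussianReal 0 1).prod (gaussianReal 0 1)) =
      ∫ p in Set.Ioi (0 : ℝ) ×ˢ Set.Ioo (-Real.pi) Real.pi,
        p.1 * ((2 * Real.pi)⁻¹ * Real.exp (-(1 / 2) * p.1 ^ 2) *
          f (p.1 * Real.cos p.2, p.1 * Real.sin p.2)) := by
  rw [gaussianReal_of_var_ne_zero _ one_ne_zero,
    prod_withDensity (measurable_gaussianPDF _ _) (measurable_gaussianPDF _ _),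
    integral_withDensity_eq_integral_toReal_smul (by fun_prop)
      (ae_of_all _ fun x => ENNReal.mul_lt_top gaussianPDF_lt_top gaussianPDF_lt_top)]
  rw [← Measure.volume_eq_prod, ← integral_comp_polarCoord_symm]
  simp only [polarCoord_target, polarCoord_symm_apply]
  refine setIntegral_congr_fun (by measurability) ?_
  rintro ⟨r, t⟩ -
  simp only [ENNReal.toReal_mul, toReal_gaussianPDF, gaussianPDFReal, smul_eq_mul]
  have : Real.exp (-(1 / 2) * r ^ 2) = Real.exp (-(r * Real.cos t - 0) ^ 2 / (2 * (1 : NNReal)))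
      * Real.exp (-(r * Real.sin t - 0) ^ 2 / (2 * (1 : NNReal))) := by
    rw [← Real.exp_add]
    congr 1
    simp only [NNReal.coe_one, sub_zero]
    linear_combination (-r ^ 2 / 2) * -(Real.sin_sq_add_cos_sq t)
  have h2 : (2 * Real.pi)⁻¹ = (Real.sqrt (2 * Real.pi * (1 : NNReal)))⁻¹ *
      (Real.sqrt (2 * Real.pi * (1 : NNReal)))⁻¹ := by
    rw [← mul_inv, Real.mul_self_sqrt (by positivity)]; simp
  rw [this, h2]
  ring

lemma radial_int (m : ℕ) (hm : m ≤ 1) :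
    ∫ r in Set.Ioi (0 : ℝ), r ^ (2 * m + 1) * Real.exp (-(1 / 2) * r ^ 2) = 2 ^ m := by
  have h := integral_rpow_mul_exp_neg_mul_rpow (p := 2) (q := 2 * m + 1) (b := 1 / 2)
    (by norm_num) (by positivity |> fun (h : (0:ℝ) < 2 * m + 1) => by linarith) (by norm_num)
  have e : ∀ r : ℝ, r ^ (2 * m + 1) * Real.exp (-(1 / 2) * r ^ 2) =
      r ^ (2 * (m : ℝ) + 1) * Real.exp (-(1 / 2) * r ^ (2 : ℝ)) := by
    intro r
    rw [show (2 * (m : ℝ) + 1) = ((2 * m + 1 : ℕ) : ℝ) by push_cast; ring, Real.rpow_natCast,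
      show (2 : ℝ) = ((2 : ℕ) : ℝ) by norm_num, Real.rpow_natCast]
  simp_rw [e]
  rw [h]
  interval_cases m
  · norm_num [Real.rpow_neg_one]
  · norm_num

/-- the angular integral over a fundamental domain -/
lemma angular_base (m : ℕ) {φ : ℝ} (h0 : 0 ≤ φ) (hπ : φ ≤ Real.pi) :
    ∫ x in (-(Real.pi / 2))..(-(Real.pi / 2) + 2 * Real.pi),
      rsFun m (Real.cos x) * rsFun m (Real.cos (x - φ)) =
    ∫ x in (φ - Real.pi / 2)..(Real.pi / 2), (Real.cos x * Real.cos (x - φ)) ^ m := by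
  have hp := Real.pi_pos
  rw [intervalIntegral.integral_of_le (by linarith), intervalIntegral.integral_of_le (by linarith),
    integral_Ioc_eq_integral_Ioo (x := φ - Real.pi / 2)]
  have : Set.Ioo (φ - Real.pi / 2) (Real.pi / 2) =
      Set.Ioc (-(Real.pi / 2)) (-(Real.pi / 2) + 2 * Real.pi) ∩
        Set.Ioo (φ - Real.pi / 2) (Real.pi / 2) := by
    ext x; simp only [Set.mem_Ioo, Set.mem_inter_iff, Set.mem_Ioc]
    constructor
    · rintro ⟨h1, h2⟩; refine ⟨⟨?_, ?_⟩, h1, h2⟩ <;> linarith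
    · exact fun h => h.2
  rw [this, ← setIntegral_indicator measurableSet_Ioo]
  refine setIntegral_congr_fun measurableSet_Ioc ?_
  rintro x ⟨hx1, hx2⟩
  by_cases hx : x ∈ Set.Ioo (φ - Real.pi / 2) (Real.pi / 2)
  · simp only [Set.indicator_of_mem hx]
    have c1 : 0 < Real.cos x := Real.cos_pos_of_mem_Ioo ⟨hx1, hx.2⟩
    have c2 : 0 < Real.cos (x - φ) :=
      Real.cos_pos_of_mem_Ioo ⟨by linarith [hx.1], by linarith [hx.2]⟩
    simp [rsFun, step, c1, c2, mul_pow]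
  · simp only [Set.indicator_of_notMem hx]
    by_cases hx3 : x < Real.pi / 2
    · have hx4 : x ≤ φ - Real.pi / 2 := by
        by_contra! h; exact hx ⟨h, hx3⟩
      have c2 : Real.cos (x - φ) ≤ 0 := by
        rw [← Real.cos_neg]
        exact Real.cos_nonpos_of_pi_div_two_le_of_le (by linarith) (by linarith)
      simp [rsFun, step, not_lt.mpr c2]
    · have c2 : Real.cos x ≤ 0 :=
        Real.cos_nonpos_of_pi_div_two_le_of_le (by linarith) (by linarith)
      simp [rsFun, step, not_lt.mpr c2]

lemma angular_int (m : ℕ) {φ p q : ℝ} (h0 : 0 ≤ φ) (hπ : φ ≤ Real.pi)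
    (hpq : Real.cos (p - q) = Real.cos φ) :
    ∫ x in Set.Ioo (-Real.pi) Real.pi,
      rsFun m (Real.cos (x - p)) * rsFun m (Real.cos (x - q)) =
    ∫ x in (φ - Real.pi / 2)..(Real.pi / 2), (Real.cos x * Real.cos (x - φ)) ^ m := by
  have hp := Real.pi_pos
  rw [← integral_Ioc_eq_integral_Ioo, ← intervalIntegral.integral_of_le (by linarith),
    ← angular_base m h0 hπ]
  set h : ℝ → ℝ := fun x => rsFun m (Real.cos x) * rsFun m (Real.cos (x - φ)) with hh
  have hper : Function.Periodic h (2 * Real.pi) := by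
    intro x
    simp only [hh]
    rw [Real.cos_add_two_pi, show x + 2 * Real.pi - φ = (x - φ) + 2 * Real.pi by ring,
      Real.cos_add_two_pi]
  obtain ⟨k, hk | hk⟩ := Real.cos_eq_cos_iff.1 hpq
  · have e : ∀ x, rsFun m (Real.cos (x - p)) * rsFun m (Real.cos (x - q)) = h (-(x - p)) := by
      intro x
      simp only [hh]
      rw [Real.cos_neg, show x - q = -(-(x - p) - φ) + (k : ℤ) * (2 * Real.pi) * (-1) by
        linarith, show -(-(x - p) - φ) + (k : ℤ) * (2 * Real.pi) * (-1) =
          -(-(x - p) - φ) - (k : ℤ) * (2 * Real.pi) by ring, Real.cos_sub_int_mul_two_pi,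
        Real.cos_neg (-(x - p) - φ)]
    simp_rw [e]
    rw [intervalIntegral.integral_comp_sub_right (fun x => h (-x)),
      intervalIntegral.integral_comp_neg,
      show -(-Real.pi - p) = -(Real.pi - p) + 2 * Real.pi by ring]
    exact hper.intervalIntegral_add_eq _ _
  · have e : ∀ x, rsFun m (Real.cos (x - p)) * rsFun m (Real.cos (x - q)) = h (x - p) := by
      intro x
      simp only [hh]
      rw [show x - q = (x - p - φ) + (k : ℤ) * (2 * Real.pi) by
        linarith, Real.cos_add_int_mul_two_pi]
    simp_rw [e]
    rw [intervalIntegral.integral_comp_sub_right (fun x => h x),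
      show Real.pi - p = (-Real.pi - p) + 2 * Real.pi by ring]
    exact hper.intervalIntegral_add_eq _ _

lemma exists_polar (x y a : ℝ) (ha : 0 < a) (h : x ^ 2 + y ^ 2 = a ^ 2) :
    ∃ p, x = a * Real.cos p ∧ y = a * Real.sin p := by
  have hn : ‖(⟨x, y⟩ : ℂ)‖ = a := by
    rw [Complex.norm_def, Complex.normSq_mk, ← sq, ← sq, h, Real.sqrt_sq ha.le]
  refine ⟨Complex.arg ⟨x, y⟩, ?_, ?_⟩
  · rw [← hn, Complex.norm_mul_cos_arg]
  · rw [← hn, Complex.norm_mul_sin_arg]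

lemma psdSqrt_mul (Λ : Matrix (Fin 2) (Fin 2) ℝ) (h : Λ.PosSemidef) :
    psdSqrt Λ * (psdSqrt Λ).transpose = Λ := by
  have hs := h.1.spectral_theorem
  rw [Unitary.conjStarAlgAut_apply] at hs
  simp only [psdSqrt, dif_pos h, Matrix.PosSemidef.sqrt]
  set U := h.1.eigenvectorUnitary
  have hU : (star U : Matrix (Fin 2) (Fin 2) ℝ) * U.1 = 1 := Unitary.coe_star_mul_self U
  rw [← Matrix.conjTranspose_eq_transpose_of_trivial, Matrix.conjTranspose_mul,
    Matrix.conjTranspose_mul, ← Matrix.star_eq_conjTranspose, ← Matrix.star_eq_conjTranspose,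
    ← Matrix.star_eq_conjTranspose, star_star]
  conv_rhs => rw [hs]
  have hD : Matrix.diagonal (Real.sqrt ∘ h.1.eigenvalues) *
      star (Matrix.diagonal (Real.sqrt ∘ h.1.eigenvalues)) =
      Matrix.diagonal (RCLike.ofReal ∘ h.1.eigenvalues) := by
    rw [Matrix.star_eq_conjTranspose, Matrix.diagonal_conjTranspose, Matrix.diagonal_mul_diagonal]
    congr 1
    ext i
    simp [Real.mul_self_sqrt (h.eigenvalues_nonneg i)]
  rw [← hD]
  calc _ = U.1 * Matrix.diagonal (Real.sqrt ∘ h.1.eigenvalues) * ((star U : Matrix (Fin 2) (Fin 2) ℝ) * U.1) *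
      (star (Matrix.diagonal (Real.sqrt ∘ h.1.eigenvalues)) * (star U : Matrix (Fin 2) (Fin 2) ℝ)) := by
        simp only [Matrix.mul_assoc]
        try rfl
    _ = _ := by rw [hU, Matrix.mul_one]; simp only [Matrix.mul_assoc]; try rfl

lemma psd_cov {a b c : ℝ} (h1 : -1 ≤ c) (h2 : c ≤ 1) :
    (!![a ^ 2, a * b * c; a * b * c, b ^ 2] : Matrix (Fin 2) (Fin 2) ℝ).PosSemidef := by
  refine Matrix.PosSemidef.of_dotProduct_mulVec_nonneg ?_ ?_
  · ext i j; fin_cases i <;> fin_cases j <;> simp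
  · intro x
    simp [Matrix.mulVec, dotProduct, Fin.sum_univ_two]
    nlinarith [sq_nonneg (a * x 0 + c * b * x 1), mul_nonneg (mul_nonneg (sub_nonneg.2 h2) (by linarith : 0 ≤ 1 + c)) (sq_nonneg (b * x 1))]

lemma gaussian2_int (m : ℕ) (hm : m ≤ 1) {a b c : ℝ} (ha : 0 < a) (hb : 0 < b)
    (h1 : -1 ≤ c) (h2 : c ≤ 1) :
    ∫ w, rsFun m (w 0) * rsFun m (w 1) ∂(gaussian2 !![a ^ 2, a * b * c; a * b * c, b ^ 2]) =
    (a * b) ^ m * (2 * Real.pi)⁻¹ * 2 ^ m *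
      ∫ x in (Real.arccos c - Real.pi / 2)..(Real.pi / 2),
        (Real.cos x * Real.cos (x - Real.arccos c)) ^ m := by
  have hS := psdSqrt_mul _ (psd_cov (a := a) (b := b) h1 h2)
  unfold gaussian2
  set S := psdSqrt !![a ^ 2, a * b * c; a * b * c, b ^ 2]
  have hrs := measurable_rsFun m
  have e00 := congrFun (congrFun hS 0) 0
  have e01 := congrFun (congrFun hS 0) 1
  have e11 := congrFun (congrFun hS 1) 1
  simp [Matrix.mul_apply, Fin.sum_univ_two] at e00 e01 e11
  obtain ⟨p, hp1, hp2⟩ := exists_polar (S 0 0) (S 0 1) a ha (by linarith)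
  obtain ⟨q, hq1, hq2⟩ := exists_polar (S 1 0) (S 1 1) b hb (by linarith)
  have hpq : Real.cos (p - q) = Real.cos (Real.arccos c) := by
    rw [Real.cos_arccos h1 h2, Real.cos_sub]
    rw [hp1, hp2, hq1, hq2] at e01
    have hab : a * b ≠ 0 := by positivity
    apply mul_left_cancel₀ hab
    linarith
  rw [integral_map (by fun_prop) (by
    refine Measurable.aestronglyMeasurable ?_
    fun_prop)]
  have hmp := measurePreserving_finTwoArrow (gaussianReal 0 1)
  have hcov := hmp.integral_comp MeasurableEquiv.finTwoArrow.measurableEmbedding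
    (fun v : ℝ × ℝ => rsFun m (S 0 0 * v.1 + S 0 1 * v.2) * rsFun m (S 1 0 * v.1 + S 1 1 * v.2))
  have hl : ∀ w : Fin 2 → ℝ, rsFun m (S.mulVec w 0) * rsFun m (S.mulVec w 1) =
      (fun v : ℝ × ℝ => rsFun m (S 0 0 * v.1 + S 0 1 * v.2) * rsFun m (S 1 0 * v.1 + S 1 1 * v.2))
        (MeasurableEquiv.finTwoArrow w) := by
    intro w
    simp [Matrix.mulVec, dotProduct, Fin.sum_univ_two, MeasurableEquiv.finTwoArrow,
      MeasurableEquiv.piFinTwo]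
  simp_rw [hl]
  rw [hcov, gauss_polar]
  rw [← angular_int m (Real.arccos_nonneg c) (Real.arccos_le_pi c) hpq, ← radial_int m hm,
    mul_assoc, ← setIntegral_prod_mul, ← integral_const_mul, ← Measure.volume_eq_prod]
  refine setIntegral_congr_fun (by measurability) ?_
  rintro ⟨r, t⟩ ⟨hr, -⟩
  have hr' : 0 < r := hr
  simp only
  rw [hp1, hp2, hq1, hq2,
    show a * Real.cos p * (r * Real.cos t) + a * Real.sin p * (r * Real.sin t) =
      (a * r) * Real.cos (t - p) by rw [Real.cos_sub]; ring,
    show b * Real.cos q * (r * Real.cos t) + b * Real.sin q * (r * Real.sin t) =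
      (b * r) * Real.cos (t - q) by rw [Real.cos_sub]; ring,
    rsFun_mul m (by positivity), rsFun_mul m (by positivity)]
  ring

lemma step_int {a b c : ℝ} (ha : 0 < a) (hb : 0 < b) (h1 : -1 ≤ c) (h2 : c ≤ 1) :
    2 * ∫ w, step (w 0) * step (w 1) ∂(gaussian2 !![a ^ 2, a * b * c; a * b * c, b ^ 2]) =
      kappa0 c := by
  simp_rw [step_eq_rsFun]
  rw [gaussian2_int 0 (by norm_num) ha hb h1 h2]
  have := Real.pi_ne_zero
  simp [kappa0]
  field_simp
  ring

lemma relu_int {a b c : ℝ} (ha : 0 < a) (hb : 0 < b) (h1 : -1 ≤ c) (h2 : c ≤ 1) :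
    2 * ∫ w, relu (w 0) * relu (w 1) ∂(gaussian2 !![a ^ 2, a * b * c; a * b * c, b ^ 2]) =
      a * b * kappa1 c := by
  simp_rw [relu_eq_rsFun]
  rw [gaussian2_int 1 (by norm_num) ha hb h1 h2]
  have := Real.pi_ne_zero
  have hc := Real.cos_arccos h1 h2
  have hs := Real.sin_arccos c
  have key : ∫ x in (Real.arccos c - Real.pi / 2)..(Real.pi / 2),
        (Real.cos x * Real.cos (x - Real.arccos c)) ^ 1 =
      (1 / 2) * (Real.sqrt (1 - c ^ 2) + c * (Real.pi - Real.arccos c)) := by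
    rw [← hs]
    set φ := Real.arccos c
    have hd : ∀ x ∈ Set.uIcc (φ - Real.pi / 2) (Real.pi / 2),
        HasDerivAt (fun x => (1 / 2) * (c * x + Real.sin (2 * x - φ) / 2))
          ((Real.cos x * Real.cos (x - φ)) ^ 1) x := by
      intro x _
      have h := (((hasDerivAt_id x).const_mul c).add
        ((((hasDerivAt_id x).const_mul 2).sub_const φ).sin.div_const 2)).const_mul (1 / 2)
      refine h.congr_deriv ?_
      simp only [id, pow_one]
      have e1 : Real.cos (2 * x - φ) = Real.cos x * Real.cos (x - φ) - Real.sin x * Real.sin (x - φ) := by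
        rw [← Real.cos_add]; congr 1; ring
      have e2 : c = Real.cos x * Real.cos (x - φ) + Real.sin x * Real.sin (x - φ) := by
        rw [← Real.cos_sub, ← hc]; congr 1; ring
      rw [e1]
      linear_combination (1 / 2) * e2
    rw [intervalIntegral.integral_eq_sub_of_hasDerivAt hd
      (Continuous.intervalIntegrable (by fun_prop) _ _)]
    rw [show 2 * (Real.pi / 2) - φ = Real.pi - φ by ring,
      show 2 * (φ - Real.pi / 2) - φ = -(Real.pi - φ) by ring, Real.sin_neg, Real.sin_pi_sub]
    ring
  rw [key]
  simp only [kappa1]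
  field_simp

lemma kappa1_mem {c : ℝ} (h1 : -1 ≤ c) (h2 : c ≤ 1) : -1 ≤ kappa1 c ∧ kappa1 c ≤ 1 := by
  have hp := Real.pi_pos
  have l := Real.arccos_nonneg c
  have u := Real.arccos_le_pi c
  have hs : Real.sqrt (1 - c ^ 2) ≤ Real.arccos c := by
    rw [← Real.sin_arccos]; exact Real.sin_le l
  have hs0 := Real.sqrt_nonneg (1 - c ^ 2)
  unfold kappa1
  rw [one_div, inv_mul_eq_div, le_div_iff₀ hp, div_le_iff₀ hp]
  constructor <;> nlinarith

lemma kappa1_one : kappa1 1 = 1 := by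
  have := Real.pi_ne_zero
  simp [kappa1]

lemma SigmaRelu_mem (n : ℕ) {c : ℝ} (h1 : -1 ≤ c) (h2 : c ≤ 1) :
    -1 ≤ SigmaRelu n c ∧ SigmaRelu n c ≤ 1 := by
  induction n with
  | zero => exact ⟨h1, h2⟩
  | succ n ih => exact kappa1_mem ih.1 ih.2

lemma SigmaRelu_one (n : ℕ) : SigmaRelu n 1 = 1 := by
  induction n with
  | zero => rfl
  | succ n ih => rw [SigmaRelu, ih, kappa1_one]

lemma cos_mem {d : ℕ} (y z : EuclideanSpace ℝ (Fin d)) :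
    -1 ≤ (inner ℝ y z : ℝ) / (‖y‖ * ‖z‖) ∧ (inner ℝ y z : ℝ) / (‖y‖ * ‖z‖) ≤ 1 :=
  abs_le.1 (abs_real_inner_div_norm_mul_norm_le_one y z)

lemma LambdaMat_eq {d : ℕ} (n : ℕ)
    (ih : ∀ y z : EuclideanSpace ℝ (Fin d), y ≠ 0 → z ≠ 0 →
      SigmaDP d n y z = ‖y‖ * ‖z‖ * SigmaRelu n ((inner ℝ y z : ℝ) / (‖y‖ * ‖z‖)))
    (y z : EuclideanSpace ℝ (Fin d)) (hy : y ≠ 0) (hz : z ≠ 0) :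
    LambdaMat (SigmaDP d n) y z =
      !![‖y‖ ^ 2, ‖y‖ * ‖z‖ * SigmaRelu n ((inner ℝ y z : ℝ) / (‖y‖ * ‖z‖));
        ‖y‖ * ‖z‖ * SigmaRelu n ((inner ℝ y z : ℝ) / (‖y‖ * ‖z‖)), ‖z‖ ^ 2] := by
  have hself : ∀ x : EuclideanSpace ℝ (Fin d), x ≠ 0 → SigmaDP d n x x = ‖x‖ ^ 2 := by
    intro x hx
    have hx' : ‖x‖ * ‖x‖ ≠ 0 := by simpa using hx
    rw [ih x x hx hx, real_inner_self_eq_norm_mul_norm, div_self hx', SigmaRelu_one]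
    ring
  unfold LambdaMat
  rw [hself y hy, hself z hz, ih y z hy hz, ih z y hz hy, real_inner_comm, mul_comm ‖z‖ ‖y‖]

lemma SigmaDP_eq {d : ℕ} (n : ℕ) : ∀ y z : EuclideanSpace ℝ (Fin d), y ≠ 0 → z ≠ 0 →
      SigmaDP d n y z = ‖y‖ * ‖z‖ * SigmaRelu n ((inner ℝ y z : ℝ) / (‖y‖ * ‖z‖)) := by
  induction n with
  | zero =>
    intro y z hy hz
    have hy' := norm_ne_zero_iff.2 hy
    have hz' := norm_ne_zero_iff.2 hz
    simp only [SigmaDP, SigmaRelu]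
    field_simp
  | succ n ih =>
    intro y z hy hz
    have hm := SigmaRelu_mem n (cos_mem y z).1 (cos_mem y z).2
    simp only [SigmaDP, SigmaRelu]
    rw [LambdaMat_eq n ih y z hy hz,
      relu_int (norm_pos_iff.2 hy) (norm_pos_iff.2 hz) hm.1 hm.2]

theorem ntk_dp_eq_relu_ntk (d L : ℕ) (y z : EuclideanSpace ℝ (Fin d))
    (hy : y ≠ 0) (hz : z ≠ 0) :
    ThetaDP d L y z = ‖y‖ * ‖z‖ * KRelu L ((inner ℝ y z : ℝ) / (‖y‖ * ‖z‖)) := by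
  induction L with
  | zero => exact SigmaDP_eq 0 y z hy hz
  | succ n ih =>
    have hm := SigmaRelu_mem n (cos_mem y z).1 (cos_mem y z).2
    have hdot : SigmaDotDP d (n + 1) y z =
        SigmaDotRelu (n + 1) ((inner ℝ y z : ℝ) / (‖y‖ * ‖z‖)) := by
      simp only [SigmaDotDP, SigmaDotRelu, Nat.add_sub_cancel]
      rw [LambdaMat_eq n (SigmaDP_eq n) y z hy hz,
        step_int (norm_pos_iff.2 hy) (norm_pos_iff.2 hz) hm.1 hm.2]
    simp only [ThetaDP, KRelu]
    rw [ih, hdot, SigmaDP_eq (n + 1) y z hy hz]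
    ring
end

section
/- There is a universal constant C > 0 such that for all integers d ≥ 1 and L ≥ 2 and all ε, δ ∈ (0,1), there exist an integer m ≤ C·( (L⁶/ε⁴)·log(L/δ) + (L²/ε²)·log³(L/(εδ)) ), a probability space (Ω, P), and a map Ψ : Ω → (ℝ^d → ℝ^m) such that for every pair of nonzero vectors y, z ∈ ℝ^d, P({ω : |⟨Ψ(ω)(y), Ψ(ω)(z)⟩ − Θ_ntk^(L)(y,z)| > ε·Θ_ntk^(L)(y,z)}) ≤ δ. -/
open MeasureTheory

/-- The `L`-layered fully-connected ReLU NTK `Θ_ntk^(L)(y,z)`. -/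
noncomputable def ThetaNTK (d L : ℕ) (y z : EuclideanSpace ℝ (Fin d)) : ℝ :=
  ‖y‖ * ‖z‖ * KRelu L ((inner ℝ y z : ℝ) / (‖y‖ * ‖z‖))


open Polynomial in
/-- `f` is a uniform limit on `[-1,1]` of polynomials with nonnegative coefficients. -/
def NNApprox (f : ℝ → ℝ) : Prop :=
  ∀ η : ℝ, 0 < η → ∃ p : NNReal[X], ∀ x ∈ Set.Icc (-1 : ℝ) 1, |f x - aeval x p| ≤ η

namespace NNApprox

open Polynomial

lemma of_limit {f : ℝ → ℝ} (h : ∀ η : ℝ, 0 < η → ∃ g, NNApprox g ∧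
    ∀ x ∈ Set.Icc (-1 : ℝ) 1, |f x - g x| ≤ η) : NNApprox f := by
  intro η hη
  obtain ⟨g, hg, hfg⟩ := h (η / 2) (by positivity)
  obtain ⟨p, hp⟩ := hg (η / 2) (by positivity)
  refine ⟨p, fun x hx => ?_⟩
  calc |f x - aeval x p| = |(f x - g x) + (g x - aeval x p)| := by congr 1; ring
    _ ≤ |f x - g x| + |g x - aeval x p| := abs_add_le _ _
    _ ≤ η := by linarith [hfg x hx, hp x hx]

lemma poly (p : NNReal[X]) : NNApprox (fun x => aeval x p) :=
  fun η hη => ⟨p, fun x _ => by simpa using hη.le⟩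

lemma congr {f g : ℝ → ℝ} (hf : NNApprox f) (h : ∀ x ∈ Set.Icc (-1 : ℝ) 1, g x = f x) :
    NNApprox g :=
  of_limit fun η hη => ⟨f, hf, fun x hx => by simpa [h x hx] using hη.le⟩

lemma const {c : ℝ} (hc : 0 ≤ c) : NNApprox (fun _ => c) := by
  refine (poly (C c.toNNReal)).congr fun x _ => ?_
  rw [aeval_C, NNReal.algebraMap_eq_coe, Real.coe_toNNReal c hc]

lemma id' : NNApprox (fun x => x) := by
  refine (poly X).congr fun x _ => ?_
  simp

lemma add {f g : ℝ → ℝ} (hf : NNApprox f) (hg : NNApprox g) : NNApprox (fun x => f x + g x) := by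
  intro η hη
  obtain ⟨p, hp⟩ := hf (η / 2) (by positivity)
  obtain ⟨q, hq⟩ := hg (η / 2) (by positivity)
  refine ⟨p + q, fun x hx => ?_⟩
  rw [map_add]
  have := abs_add_le (f x - aeval x p) (g x - aeval x q)
  rw [show f x + g x - (aeval x p + aeval x q) = (f x - aeval x p) + (g x - aeval x q) by ring]
  linarith [hp x hx, hq x hx]

lemma bdd {f : ℝ → ℝ} (hf : NNApprox f) : ∃ B : ℝ, 0 < B ∧ ∀ x ∈ Set.Icc (-1 : ℝ) 1, |f x| ≤ B := by
  obtain ⟨p, hp⟩ := hf 1 one_pos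
  have hc : ContinuousOn (fun x : ℝ => aeval x p) (Set.Icc (-1 : ℝ) 1) :=
    (Polynomial.continuous_aeval p).continuousOn
  obtain ⟨B, hB⟩ := isCompact_Icc.exists_bound_of_continuousOn hc
  refine ⟨|B| + 1, by positivity, fun x hx => ?_⟩
  have h1 := hB x hx
  rw [Real.norm_eq_abs] at h1
  have := abs_add_le (f x - aeval x p) (aeval x p)
  rw [sub_add_cancel] at this
  linarith [hp x hx, le_abs_self B]

lemma mul {f g : ℝ → ℝ} (hf : NNApprox f) (hg : NNApprox g) : NNApprox (fun x => f x * g x) := by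
  obtain ⟨B, hB0, hB⟩ := hf.bdd
  intro η hη
  obtain ⟨q, hq⟩ := hg (η / 2 / B) (by positivity)
  obtain ⟨D, hD0, hD⟩ := (poly q).bdd
  obtain ⟨p, hp⟩ := hf (η / 2 / D) (by positivity)
  refine ⟨p * q, fun x hx => ?_⟩
  rw [map_mul]
  have := abs_add_le (f x * (g x - aeval x q)) ((f x - aeval x p) * aeval x q)
  rw [show f x * g x - (aeval x p * aeval x q) =
    f x * (g x - aeval x q) + (f x - aeval x p) * aeval x q by ring]
  rw [abs_mul, abs_mul] at this
  have h1 : |f x| * |g x - aeval x q| ≤ B * (η / 2 / B) :=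
    mul_le_mul (hB x hx) (hq x hx) (abs_nonneg _) hB0.le
  have h2 : |f x - aeval x p| * |aeval x q| ≤ (η / 2 / D) * D :=
    mul_le_mul (hp x hx) (hD x hx) (abs_nonneg _) (by positivity)
  have h3 : B * (η / 2 / B) = η / 2 := by field_simp
  have h4 : (η / 2 / D) * D = η / 2 := by field_simp
  linarith

lemma poly_comp (p : NNReal[X]) {g : ℝ → ℝ} (hg : NNApprox g) :
    NNApprox (fun x => aeval (g x) p) := by
  induction p using Polynomial.induction_on' with
  | add p q hp hq => simpa using hp.add hq
  | monomial n a =>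
    have hpow : NNApprox (fun x => g x ^ n) := by
      induction n with
      | zero => simpa using const zero_le_one
      | succ k ih => simpa [pow_succ] using ih.mul hg
    refine ((const a.2).mul hpow).congr fun x _ => ?_
    rw [aeval_monomial]
    rfl

lemma comp {f g : ℝ → ℝ} (hf : NNApprox f) (hg : NNApprox g)
    (hmap : ∀ x ∈ Set.Icc (-1 : ℝ) 1, g x ∈ Set.Icc (-1 : ℝ) 1) : NNApprox (fun x => f (g x)) := by
  refine of_limit fun η hη => ?_
  obtain ⟨p, hp⟩ := hf η hη
  exact ⟨_, poly_comp p hg, fun x hx => hp _ (hmap x hx)⟩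

lemma exists_antideriv (p : NNReal[X]) : ∃ q : NNReal[X], aeval (0 : ℝ) q = 0 ∧
    ∀ x : ℝ, HasDerivAt (fun x => aeval x q) (aeval x p) x := by
  induction p using Polynomial.induction_on' with
  | add p q hp hq =>
    obtain ⟨P, hP0, hP⟩ := hp
    obtain ⟨Q, hQ0, hQ⟩ := hq
    refine ⟨P + Q, by simp [hP0, hQ0], fun x => ?_⟩
    simpa using! (hP x).add (hQ x)
  | monomial n a =>
    refine ⟨monomial (n + 1) (a / (n + 1)), by simp [aeval_monomial], fun x => ?_⟩
    have h := (hasDerivAt_pow (n + 1) x).const_mul ((a : ℝ) / (n + 1))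
    simp only [aeval_monomial]
    convert! h using 1
    have : ((n : ℝ) + 1) ≠ 0 := by positivity
    change (a : ℝ) * x ^ n = _
    rw [Nat.add_sub_cancel]
    push_cast
    field_simp

lemma of_deriv {f g : ℝ → ℝ} (hg : NNApprox g) (hf0 : 0 ≤ f 0)
    (hc : ContinuousOn f (Set.Icc (-1) 1))
    (hd : ∀ x ∈ Set.Ioo (-1 : ℝ) 1, HasDerivAt f (g x) x) : NNApprox f := by
  intro η hη
  obtain ⟨p, hp⟩ := hg η hη
  obtain ⟨q, hq0, hq⟩ := exists_antideriv p
  refine ⟨C (f 0).toNNReal + q, fun x hx => ?_⟩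
  have hval : aeval x (C (f 0).toNNReal + q) = f 0 + aeval x q := by
    rw [map_add, aeval_C, NNReal.algebraMap_eq_coe, Real.coe_toNNReal _ hf0]
  rw [hval]
  have hcq : Continuous (fun x : ℝ => aeval x q) := Polynomial.continuous_aeval q
  have hch : ContinuousOn (fun x : ℝ => f x - aeval x q) (Set.Icc (-1) 1) :=
    hc.sub hcq.continuousOn
  have hdh : ∀ x ∈ Set.Ioo (-1 : ℝ) 1,
      HasDerivAt (fun x => f x - aeval x q) (g x - aeval x p) x := fun x hx =>
    (hd x hx).sub (hq x)
  obtain ⟨hx1, hx2⟩ := hx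
  have key : |(f x - aeval x q) - (f 0 - aeval (0 : ℝ) q)| ≤ η * |x| := by
    rcases lt_trichotomy x 0 with h | h | h
    · obtain ⟨c, hc1, hc2⟩ := exists_hasDerivAt_eq_slope (fun x => f x - aeval x q)
        (fun x => g x - aeval x p) h (hch.mono (Set.Icc_subset_Icc hx1 zero_le_one))
        (fun y hy => hdh y ⟨by linarith [hy.1], by linarith [hy.2]⟩)
      have h1 := hp c ⟨by linarith [hc1.1], by linarith [hc1.2]⟩
      rw [eq_div_iff (by linarith)] at hc2
      rw [abs_sub_comm, ← hc2, abs_mul, zero_sub, abs_neg]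
      gcongr
    · simp [h]
    · obtain ⟨c, hc1, hc2⟩ := exists_hasDerivAt_eq_slope (fun x => f x - aeval x q)
        (fun x => g x - aeval x p) h (hch.mono (Set.Icc_subset_Icc (by norm_num) hx2))
        (fun y hy => hdh y ⟨by linarith [hy.1], by linarith [hy.2]⟩)
      have h1 := hp c ⟨by linarith [hc1.1], by linarith [hc1.2]⟩
      rw [eq_div_iff (by linarith)] at hc2
      rw [← hc2, abs_mul, sub_zero]
      gcongr
  rw [hq0] at key
  rw [show f x - (f 0 + aeval x q) = f x - aeval x q - (f 0 - 0) by ring]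
  have : |x| ≤ 1 := abs_le.2 ⟨hx1, hx2⟩
  nlinarith

lemma choose_half_nonneg (n : ℕ) : 0 ≤ Ring.choose ((1 / 2 : ℝ) + n - 1) n := by
  rw [← Ring.multichoose_eq]
  have h := Ring.factorial_nsmul_multichoose_eq_ascPochhammer (1 / 2 : ℝ) n
  have h2 : 0 < (ascPochhammer ℕ n).smeval (1 / 2 : ℝ) := by
    rw [Polynomial.ascPochhammer_smeval_eq_eval]
    exact ascPochhammer_pos n _ (by norm_num)
  rw [← h, nsmul_eq_mul] at h2
  exact (pos_of_mul_pos_right h2 (by positivity)).le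

lemma inv_sqrt {r : ℝ} (hr0 : 0 < r) (hr1 : r < 1) :
    NNApprox (fun x => 1 / √(1 - (r * x) ^ 2)) := by
  have H := Real.one_div_one_sub_rpow_hasFPowerSeriesOnBall_zero (1 / 2)
  have hU := H.tendstoUniformlyOn (r' := r.toNNReal) (by
    rw [← ENNReal.coe_one, ENNReal.coe_lt_coe]; simpa using hr1)
  rw [Metric.tendstoUniformlyOn_iff] at hU
  intro η hη
  obtain ⟨N, hN⟩ := (hU η hη).exists
  let p : NNReal[X] := ∑ n ∈ Finset.range N,
    monomial (2 * n) ((Ring.choose ((1 / 2 : ℝ) + n - 1) n).toNNReal * r.toNNReal ^ (2 * n))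
  refine ⟨p, fun x hx => ?_⟩
  have hx1 : x ^ 2 ≤ 1 := by nlinarith [hx.1, hx.2]
  have hrx : (r * x) ^ 2 < r := by
    rw [mul_pow]; nlinarith
  have h := hN ((r * x) ^ 2) (by
    simp only [Metric.mem_ball, dist_zero_right, Real.norm_eq_abs, Real.coe_toNNReal r hr0.le]
    rw [abs_of_nonneg (sq_nonneg _)]; exact hrx)
  rw [Real.dist_eq, zero_add] at h
  have e2 : FormalMultilinearSeries.partialSum (FormalMultilinearSeries.ofScalars ℝ
      fun n : ℕ => Ring.choose ((1 / 2 : ℝ) + n - 1) n) N ((r * x) ^ 2) = aeval x p := by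
    simp only [FormalMultilinearSeries.partialSum, p, map_sum, aeval_monomial]
    refine Finset.sum_congr rfl fun n _ => ?_
    rw [FormalMultilinearSeries.ofScalars_apply_eq]
    rw [NNReal.algebraMap_eq_coe, NNReal.coe_mul, NNReal.coe_pow,
      Real.coe_toNNReal _ (choose_half_nonneg n), Real.coe_toNNReal r hr0.le]
    rw [smul_eq_mul, ← pow_mul, mul_pow, mul_assoc]
  rw [e2, ← Real.sqrt_eq_rpow] at h
  exact h.le

lemma arcsin : NNApprox Real.arcsin := by
  refine of_limit fun η hη => ?_
  have huc : UniformContinuousOn Real.arcsin (Set.Icc (-1) 1) :=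
    isCompact_Icc.uniformContinuousOn_of_continuous Real.continuous_arcsin.continuousOn
  rw [Metric.uniformContinuousOn_iff_le] at huc
  obtain ⟨ρ, hρ, H⟩ := huc η hη
  set r : ℝ := 1 - min ρ (1 / 2) with hr
  have hm0 : 0 < min ρ (1 / 2) := by positivity
  have hm1 : min ρ (1 / 2) ≤ 1 / 2 := min_le_right _ _
  have hm2 : min ρ (1 / 2) ≤ ρ := min_le_left _ _
  have hr0 : 0 < r := by linarith
  have hr1 : r < 1 := by linarith
  have hb : ∀ x ∈ Set.Icc (-1 : ℝ) 1, -1 < r * x ∧ r * x < 1 := fun x hx =>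
    ⟨by nlinarith [hx.1, hx.2], by nlinarith [hx.1, hx.2]⟩
  refine ⟨fun x => Real.arcsin (r * x), ?_, fun x hx => ?_⟩
  · refine of_deriv ((const hr0.le).mul (inv_sqrt hr0 hr1)) (by simp)
      (Real.continuous_arcsin.comp (continuous_const.mul continuous_id)).continuousOn ?_
    intro x hx
    have hx' := hb x ⟨hx.1.le, hx.2.le⟩
    have h1 := Real.hasDerivAt_arcsin (x := r * x) (by linarith) (by linarith)
    have h2 := h1.comp x ((hasDerivAt_id x).const_mul r)
    convert! h2 using 1
    simp [mul_comm]
  · have hx' := hb x hx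
    have := H x hx (r * x) ⟨hx'.1.le, hx'.2.le⟩ (by
      rw [Real.dist_eq, show x - r * x = min ρ (1/2) * x by rw [hr]; ring, abs_mul,
        abs_of_pos hm0]
      have : |x| ≤ 1 := abs_le.2 hx
      nlinarith)
    rwa [Real.dist_eq] at this

end NNApprox

lemma kappa0_eq (x : ℝ) : kappa0 x = 1 / 2 + 1 / Real.pi * Real.arcsin x := by
  unfold kappa0
  rw [Real.arccos]
  have := Real.pi_pos
  field_simp
  ring

lemma nnApprox_kappa0 : NNApprox kappa0 := by
  refine ((NNApprox.const (c := 1 / 2) (by norm_num)).add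
    ((NNApprox.const (c := 1 / Real.pi) (by positivity)).mul NNApprox.arcsin)).congr ?_
  exact fun x _ => kappa0_eq x

lemma kappa1_eq (x : ℝ) : kappa1 x = 1 / Real.pi * √(1 - x ^ 2) + x * kappa0 x := by
  unfold kappa0 kappa1
  ring

lemma continuous_kappa0 : Continuous kappa0 := by
  unfold kappa0
  exact continuous_const.mul (continuous_const.sub Real.continuous_arccos)

lemma continuous_kappa1 : Continuous kappa1 := by
  have : kappa1 = fun x => 1 / Real.pi * √(1 - x ^ 2) + x * kappa0 x := funext kappa1_eq
  rw [this]
  have := continuous_kappa0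
  fun_prop

lemma hasDerivAt_kappa1 {x : ℝ} (hx : x ∈ Set.Ioo (-1 : ℝ) 1) :
    HasDerivAt kappa1 (kappa0 x) x := by
  have : kappa1 = fun x => 1 / Real.pi * √(1 - x ^ 2) +
      x * (1 / 2 + 1 / Real.pi * Real.arcsin x) :=
    funext fun x => by rw [kappa1_eq, kappa0_eq]
  rw [this, kappa0_eq]
  have hpos : 0 < 1 - x ^ 2 := by nlinarith [hx.1, hx.2]
  have h1 := Real.hasDerivAt_arcsin (x := x) (by linarith [hx.1]) (by linarith [hx.2])
  have h2 := (((hasDerivAt_pow 2 x).const_sub 1).sqrt hpos.ne').const_mul (1 / Real.pi)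
  have h3 := (hasDerivAt_id x).mul ((h1.const_mul (1 / Real.pi)).const_add (1 / 2))
  convert! h2.add h3 using 1
  have hs : 0 < √(1 - x ^ 2) := Real.sqrt_pos.2 hpos
  have := Real.pi_pos
  simp
  field_simp
  ring

lemma kappa1_zero : kappa1 0 = 1 / Real.pi := by
  simp [kappa1]

lemma nnApprox_kappa1 : NNApprox kappa1 :=
  NNApprox.of_deriv nnApprox_kappa0 (by rw [kappa1_zero]; positivity)
    continuous_kappa1.continuousOn fun _ hx => hasDerivAt_kappa1 hx

lemma kappa0_nonneg (x : ℝ) : 0 ≤ kappa0 x := by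
  unfold kappa0
  have := Real.arccos_le_pi x
  have := Real.pi_pos
  exact mul_nonneg (by positivity) (by linarith)

lemma kappa0_le_one (x : ℝ) : kappa0 x ≤ 1 := by
  unfold kappa0
  have := Real.arccos_nonneg x
  have := Real.pi_pos
  rw [one_div, inv_mul_le_iff₀ this]
  linarith

lemma monotoneOn_kappa1 : MonotoneOn kappa1 (Set.Icc (-1) 1) := by
  refine monotoneOn_of_deriv_nonneg (convex_Icc _ _) continuous_kappa1.continuousOn ?_ ?_
  · rw [interior_Icc]
    exact fun x hx => (hasDerivAt_kappa1 hx).differentiableAt.differentiableWithinAt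
  · rw [interior_Icc]
    intro x hx
    rw [(hasDerivAt_kappa1 hx).deriv]
    exact kappa0_nonneg x

lemma kappa1_mem_s8 {x : ℝ} (hx : x ∈ Set.Icc (-1 : ℝ) 1) : kappa1 x ∈ Set.Icc (0 : ℝ) 1 := by
  have h1 : kappa1 (-1) = 0 := by simp [kappa1]
  have h2 : kappa1 1 = 1 := by simp [kappa1]
  constructor
  · rw [← h1]; exact monotoneOn_kappa1 (by simp) hx hx.1
  · rw [← h2]; exact monotoneOn_kappa1 hx (by simp) hx.2

lemma sigmaRelu_mem (n : ℕ) {x : ℝ} (hx : x ∈ Set.Icc (-1 : ℝ) 1) :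
    SigmaRelu n x ∈ Set.Icc (-1 : ℝ) 1 := by
  induction n with
  | zero => simpa [SigmaRelu] using hx
  | succ n ih =>
    have := kappa1_mem_s8 ih
    rw [SigmaRelu]
    exact ⟨by linarith [this.1], this.2⟩

lemma sigmaRelu_succ_mem (n : ℕ) {x : ℝ} (hx : x ∈ Set.Icc (-1 : ℝ) 1) :
    SigmaRelu (n + 1) x ∈ Set.Icc (0 : ℝ) 1 := by
  rw [SigmaRelu]
  exact kappa1_mem_s8 (sigmaRelu_mem n hx)

lemma nnApprox_sigma (n : ℕ) : NNApprox (SigmaRelu n) := by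
  induction n with
  | zero => exact NNApprox.id'.congr fun x _ => by simp [SigmaRelu]
  | succ n ih =>
    exact (nnApprox_kappa1.comp ih fun x hx => sigmaRelu_mem n hx).congr fun x _ => by
      simp [SigmaRelu]

lemma nnApprox_K (n : ℕ) : NNApprox (KRelu n) := by
  induction n with
  | zero => exact NNApprox.id'.congr fun x _ => by simp [KRelu]
  | succ n ih =>
    exact ((ih.mul (nnApprox_kappa0.comp (nnApprox_sigma n) fun x hx => sigmaRelu_mem n hx)).add
      (nnApprox_sigma (n + 1))).congr fun x _ => by simp [KRelu, SigmaDotRelu]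

lemma abs_K_le (n : ℕ) {x : ℝ} (hx : x ∈ Set.Icc (-1 : ℝ) 1) : |KRelu n x| ≤ n + 1 := by
  induction n with
  | zero => simpa [KRelu] using abs_le.2 hx
  | succ n ih =>
    rw [KRelu]
    have h1 := sigmaRelu_succ_mem n hx
    have h2 : 0 ≤ SigmaDotRelu (n + 1) x := kappa0_nonneg _
    have h3 : SigmaDotRelu (n + 1) x ≤ 1 := kappa0_le_one _
    refine (abs_add_le _ _).trans ?_
    rw [abs_mul, abs_of_nonneg h1.1, abs_of_nonneg h2]
    push_cast
    nlinarith [h1.2, abs_nonneg (KRelu n x)]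

lemma kappa1_ge {x : ℝ} (hx : x ∈ Set.Icc (0 : ℝ) 1) : 1 / Real.pi ≤ kappa1 x := by
  rw [← kappa1_zero]
  exact monotoneOn_kappa1 (by simp) ⟨by linarith [hx.1], hx.2⟩ hx.1

lemma K_one_ge {x : ℝ} (hx : x ∈ Set.Icc (-1 : ℝ) 1) : -(69 / 250 : ℝ) ≤ KRelu 1 x := by
  have e : KRelu 1 x = x * kappa0 x + kappa1 x := by
    simp [KRelu, SigmaDotRelu, SigmaRelu]
  rw [e]
  have h1 := (kappa1_mem_s8 hx).1
  have h0 := kappa0_nonneg x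
  by_contra! hlt
  have hM : x * kappa0 x < -(69 / 250) := by linarith
  have hxneg : x < 0 := by nlinarith
  have hk0 : kappa0 x ≤ 1 / 2 := by
    rw [kappa0_eq]
    have : Real.arcsin x ≤ 0 := Real.arcsin_nonpos.2 hxneg.le
    have := mul_nonpos_of_nonneg_of_nonpos (a := 1 / Real.pi) (by positivity) this
    linarith
  have hA : x < -(69 / 125) := by nlinarith
  rw [kappa1_eq] at h1
  have hs : 69 / 250 < 1 / Real.pi * √(1 - x ^ 2) := by linarith
  rw [one_div, lt_inv_mul_iff₀ Real.pi_pos] at hs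
  have hp : 3.14 < Real.pi := Real.pi_gt_d2
  have hs2 : 3.14 * (69 / 250) < √(1 - x ^ 2) := by linarith
  have hs3 := Real.lt_sqrt (by norm_num) |>.1 hs2
  nlinarith

lemma K_ge {L : ℕ} (hL : 2 ≤ L) {x : ℝ} (hx : x ∈ Set.Icc (-1 : ℝ) 1) :
    (1 / 25 : ℝ) ≤ KRelu L x := by
  have hpi : (8 / 25 : ℝ) - 1 / 500 ≤ 1 / Real.pi := by
    rw [le_div_iff₀ Real.pi_pos]
    nlinarith [Real.pi_lt_d4]
  induction L, hL using Nat.le_induction with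
  | base =>
    have h1 := K_one_ge hx
    rw [KRelu]
    have h2 : 0 ≤ SigmaDotRelu (1 + 1) x := kappa0_nonneg _
    have h3 : SigmaDotRelu (1 + 1) x ≤ 1 := kappa0_le_one _
    have h4 : 1 / Real.pi ≤ SigmaRelu (1 + 1) x := kappa1_ge (sigmaRelu_succ_mem 0 hx)
    nlinarith
  | succ n hn ih =>
    rw [KRelu]
    have h2 : 0 ≤ SigmaDotRelu (n + 1) x := kappa0_nonneg _
    have h4 : 1 / Real.pi ≤ SigmaRelu (n + 1) x := by
      obtain ⟨k, rfl⟩ : ∃ k, n = k + 1 := ⟨n - 1, by omega⟩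
      exact kappa1_ge (sigmaRelu_succ_mem k hx)
    nlinarith

open Polynomial in
lemma exists_feature {E : Type*} [NormedAddCommGroup E] [InnerProductSpace ℝ E] {d : ℕ}
    (e : E → Fin d → ℝ) (he : ∀ y z, (inner ℝ y z : ℝ) = ∑ i, e y i * e z i) (p : NNReal[X]) :
    ∃ (ι : Type) (_ : Fintype ι) (φ : E → ι → ℝ),
      ∀ y z : E, aeval (inner ℝ y z : ℝ) p = ∑ i, φ y i * φ z i := by
  induction p using Polynomial.induction_on' with
  | add p q hp hq =>
    obtain ⟨ι, _, φ, hφ⟩ := hp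
    obtain ⟨κ, _, ψ, hψ⟩ := hq
    refine ⟨ι ⊕ κ, inferInstance, fun y => Sum.elim (φ y) (ψ y), fun y z => ?_⟩
    rw [map_add, hφ, hψ, Fintype.sum_sum_type]
    simp
  | monomial n a =>
    have hpow : ∃ (ι : Type) (_ : Fintype ι) (φ : E → ι → ℝ),
        ∀ y z : E, (inner ℝ y z : ℝ) ^ n = ∑ i, φ y i * φ z i := by
      induction n with
      | zero => exact ⟨Unit, inferInstance, fun _ _ => 1, fun y z => by simp⟩
      | succ k ih =>
        obtain ⟨ι, _, φ, hφ⟩ := ih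
        refine ⟨ι × Fin d, inferInstance, fun y i => φ y i.1 * e y i.2, fun y z => ?_⟩
        rw [pow_succ, hφ, he, Finset.sum_mul_sum, Fintype.sum_prod_type]
        refine Finset.sum_congr rfl fun i _ => Finset.sum_congr rfl fun j _ => ?_
        ring
    obtain ⟨ι, _, φ, hφ⟩ := hpow
    refine ⟨ι, inferInstance, fun y i => √(a : ℝ) * φ y i, fun y z => ?_⟩
    rw [aeval_monomial, hφ, NNReal.algebraMap_eq_coe, Finset.mul_sum]
    refine Finset.sum_congr rfl fun i _ => ?_
    have : √(a : ℝ) * √(a : ℝ) = a := Real.mul_self_sqrt a.2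
    linear_combination (-(φ y i * φ z i)) * this

/-- the sign attached to a boolean -/
def bsign (b : Bool) : ℝ := if b then 1 else -1

/-- Rademacher sum -/
def rad {n : ℕ} (u : Fin n → ℝ) (s : Fin n → Bool) : ℝ := ∑ i, u i * bsign (s i)

lemma sum_bool_succ {n : ℕ} (F : (Fin (n + 1) → Bool) → ℝ) :
    ∑ s, F s = ∑ s : Fin n → Bool,
      (F (Fin.cons (α := fun _ => Bool) true s) + F (Fin.cons (α := fun _ => Bool) false s)) := by
  rw [← (Fin.consEquiv (fun _ => Bool)).sum_comp, Fintype.sum_prod_type, Fintype.sum_bool,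
    ← Finset.sum_add_distrib]
  rfl

lemma rad_cons {n : ℕ} (u : Fin (n + 1) → ℝ) (b : Bool) (s : Fin n → Bool) :
    rad u (Fin.cons (α := fun _ => Bool) b s) = u 0 * bsign b + rad (fun i => u i.succ) s := by
  simp [rad, Fin.sum_univ_succ]

lemma sum_rad_mul {n : ℕ} (u v : Fin n → ℝ) :
    ∑ s, rad u s * rad v s = 2 ^ n * ∑ i, u i * v i := by
  induction n with
  | zero => simp [rad]
  | succ n ih =>
    rw [sum_bool_succ]
    simp only [rad_cons]
    have : ∀ s : Fin n → Bool,
        (u 0 * bsign true + rad (fun i => u i.succ) s) *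
          (v 0 * bsign true + rad (fun i => v i.succ) s) +
        (u 0 * bsign false + rad (fun i => u i.succ) s) *
          (v 0 * bsign false + rad (fun i => v i.succ) s) =
        2 * (u 0 * v 0) + 2 * (rad (fun i => u i.succ) s * rad (fun i => v i.succ) s) := by
      intro s; simp [bsign]; ring
    rw [Finset.sum_congr rfl fun s _ => this s, Finset.sum_add_distrib, Finset.sum_const,
      ← Finset.mul_sum, ih,
      Fin.sum_univ_succ]
    simp
    ring

lemma sum_rad_four {n : ℕ} (u : Fin n → ℝ) :
    ∑ s, rad u s ^ 4 ≤ 2 ^ n * (3 * (∑ i, u i * u i) ^ 2) := by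
  induction n with
  | zero => simp [rad]
  | succ n ih =>
    rw [sum_bool_succ]
    simp only [rad_cons]
    have : ∀ s : Fin n → Bool,
        (u 0 * bsign true + rad (fun i => u i.succ) s) ^ 4 +
        (u 0 * bsign false + rad (fun i => u i.succ) s) ^ 4 =
        2 * u 0 ^ 4 + 12 * u 0 ^ 2 * (rad (fun i => u i.succ) s * rad (fun i => u i.succ) s) +
        2 * rad (fun i => u i.succ) s ^ 4 := by
      intro s; simp [bsign]; ring
    rw [Finset.sum_congr rfl fun s _ => this s, Finset.sum_add_distrib, Finset.sum_add_distrib,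
      ← Finset.mul_sum, ← Finset.mul_sum, ← Finset.mul_sum, sum_rad_mul, Fin.sum_univ_succ]
    have ih' := ih (fun i => u i.succ)
    set A := ∑ i : Fin n, u i.succ * u i.succ
    simp only [Finset.sum_const, Finset.card_univ, Fintype.card_fun, Fintype.card_bool,
      Fintype.card_fin, nsmul_eq_mul]
    push_cast
    have h2 : (0 : ℝ) < 2 ^ n := by positivity
    have h4 : 0 ≤ (2 : ℝ) ^ n * u 0 ^ 4 := by positivity
    have e1 : (2 : ℝ) ^ (n + 1) = 2 * 2 ^ n := by ring
    rw [e1]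
    nlinarith

/-- clipping to `[-T, T]` -/
noncomputable def clip (T x : ℝ) : ℝ := max (-T) (min T x)

lemma abs_clip_le {T : ℝ} (hT : 0 ≤ T) (x : ℝ) : |clip T x| ≤ T := by
  unfold clip
  rw [abs_le]
  exact ⟨le_max_left _ _, max_le (by linarith) (min_le_left _ _)⟩

lemma abs_clip_le_abs {T : ℝ} (hT : 0 ≤ T) (x : ℝ) : |clip T x| ≤ |x| := by
  unfold clip
  rw [abs_le]
  constructor
  · refine le_max_of_le_right (le_min ?_ (neg_abs_le x))
    linarith [abs_nonneg x]
  · exact max_le (by linarith [abs_nonneg x]) ((min_le_right _ _).trans (le_abs_self x))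

lemma abs_sub_clip_le {T : ℝ} (hT : 0 < T) (x : ℝ) : |x - clip T x| ≤ |x| ^ 3 / T ^ 2 := by
  rw [le_div_iff₀ (by positivity)]
  by_cases h : |x| ≤ T
  · have : clip T x = x := by
      rw [abs_le] at h
      unfold clip
      rw [min_eq_right h.2, max_eq_right h.1]
    rw [this]; simp
  · push Not at h
    have h1 : |x - clip T x| ≤ |x| := by
      unfold clip
      rcases le_total 0 x with hx | hx
      · rw [abs_of_nonneg hx] at h ⊢
        rw [min_eq_left h.le, max_eq_right (by linarith), abs_of_nonneg (by linarith)]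
        linarith
      · rw [abs_of_nonpos hx] at h ⊢
        rw [min_eq_right (by linarith), max_eq_left (by linarith), abs_of_nonpos (by linarith)]
        linarith
    calc |x - clip T x| * T ^ 2 ≤ |x| * |x| ^ 2 := by gcongr
      _ = |x| ^ 3 := by ring

lemma clip_mul_error {T : ℝ} (hT : 0 < T) (x y : ℝ) :
    |clip T x * clip T y - x * y| ≤ (x ^ 4 + y ^ 4) / T ^ 2 := by
  have e : clip T x * clip T y - x * y =
      -(x * (y - clip T y) + clip T y * (x - clip T x)) := by ring
  rw [e, abs_neg]
  refine (abs_add_le _ _).trans ?_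
  rw [abs_mul, abs_mul]
  have h1 : |x| * |y - clip T y| ≤ |x| * (|y| ^ 3 / T ^ 2) := by
    gcongr; exact abs_sub_clip_le hT y
  have h2 : |clip T y| * |x - clip T x| ≤ |y| * (|x| ^ 3 / T ^ 2) :=
    mul_le_mul (abs_clip_le_abs hT.le y) (abs_sub_clip_le hT x) (abs_nonneg _) (abs_nonneg _)
  refine (add_le_add h1 h2).trans ?_
  rw [show |x| * (|y| ^ 3 / T ^ 2) + |y| * (|x| ^ 3 / T ^ 2) =
    (|x| * |y| ^ 3 + |y| * |x| ^ 3) / T ^ 2 by ring]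
  refine div_le_div_of_nonneg_right ?_ (by positivity)
  have h4 : ∀ a : ℝ, a ^ 4 = |a| ^ 4 := fun a => by
    rw [← abs_pow, abs_of_nonneg (by positivity)]
  rw [h4 x, h4 y]
  have hx := abs_nonneg x
  have hy := abs_nonneg y
  generalize |x| = a at *
  generalize |y| = b at *
  have : a ^ 4 + b ^ 4 - (a * b ^ 3 + b * a ^ 3) = (a - b) ^ 2 * (a ^ 2 + a * b + b ^ 2) := by ring
  have : 0 ≤ (a - b) ^ 2 * (a ^ 2 + a * b + b ^ 2) := by positivity
  linarith

lemma clip_mean_error {n : ℕ} {T B : ℝ} (hT : 0 < T) (u v : Fin n → ℝ)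
    (hu : ∑ i, u i * u i = B) (hv : ∑ i, v i * v i = B) :
    |(∑ s, clip T (rad u s) * clip T (rad v s)) / 2 ^ n - ∑ i, u i * v i| ≤ 6 * B ^ 2 / T ^ 2 := by
  have h2 : (0 : ℝ) < 2 ^ n := by positivity
  have e : (∑ s, clip T (rad u s) * clip T (rad v s)) / 2 ^ n - ∑ i, u i * v i =
      (∑ s, (clip T (rad u s) * clip T (rad v s) - rad u s * rad v s)) / 2 ^ n := by
    rw [Finset.sum_sub_distrib, sum_rad_mul]
    field_simp
  rw [e, abs_div, abs_of_pos h2, div_le_iff₀ h2]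
  calc _ ≤ ∑ s, |clip T (rad u s) * clip T (rad v s) - rad u s * rad v s| :=
        Finset.abs_sum_le_sum_abs _ _
    _ ≤ ∑ s, (rad u s ^ 4 + rad v s ^ 4) / T ^ 2 :=
        Finset.sum_le_sum fun s _ => clip_mul_error hT _ _
    _ = (∑ s, rad u s ^ 4 + ∑ s, rad v s ^ 4) / T ^ 2 := by
        rw [← Finset.sum_div, Finset.sum_add_distrib]
    _ ≤ (2 ^ n * (3 * B ^ 2) + 2 ^ n * (3 * B ^ 2)) / T ^ 2 := by
        gcongr
        · rw [← hu]; exact sum_rad_four u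
        · rw [← hv]; exact sum_rad_four v
    _ = _ := by ring

open ProbabilityTheory in
lemma hoeffding_one {S : Type} [MeasurableSpace S] (μ : Measure S) [IsProbabilityMeasure μ]
    (f : S → ℝ) (hf : Measurable f) {R : ℝ} (hR : 0 < R) (hfR : ∀ s, |f s| ≤ R) (m : ℕ) (hm : 0 < m)
    {t : ℝ} (ht : 0 ≤ t) :
    (Measure.pi fun _ : Fin m => μ).real {ω | t * m ≤ ∑ i, (f (ω i) - ∫ s, f s ∂μ)} ≤
      Real.exp (-(m * t ^ 2 / (2 * R ^ 2))) := by
  have hsub := hasSubgaussianMGF_of_mem_Icc (μ := μ) (X := f) (a := -R) (b := R) hf.aemeasurable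
    (Filter.Eventually.of_forall fun s => abs_le.1 (hfR s))
  have hind : iIndepFun (fun (i : Fin m) (ω : Fin m → S) => f (ω i) - ∫ s, f s ∂μ)
      (Measure.pi fun _ : Fin m => μ) :=
    iIndepFun_pi (X := fun _ s => f s - ∫ s, f s ∂μ) fun i => (hf.sub_const _).aemeasurable
  have h := HasSubgaussianMGF.measure_sum_ge_le_of_iIndepFun (s := Finset.univ) hind
    (c := fun _ => (‖R - -R‖₊ / 2) ^ 2) (fun i _ => by
      have hmap := (measurePreserving_eval (fun _ : Fin m => μ) i).map_eq
      refine HasSubgaussianMGF.of_map (Y := fun ω : Fin m → S => ω i)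
        (X := fun s => f s - ∫ s, f s ∂μ) (measurable_pi_apply i).aemeasurable ?_
      rw [show (fun ω : Fin m → S => ω i) = Function.eval i from rfl, hmap]
      exact hsub) (ε := t * m) (by positivity)
  refine h.trans (Real.exp_le_exp.2 (le_of_eq ?_))
  have hn : ((‖R - -R‖₊ : NNReal) : ℝ) = 2 * R := by
    rw [coe_nnnorm, Real.norm_eq_abs, abs_of_nonneg (by linarith)]; ring
  have hm' : (0 : ℝ) < m := by exact_mod_cast hm
  simp only [Finset.sum_const, Finset.card_univ, Fintype.card_fin, nsmul_eq_mul]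
  push_cast
  rw [← coe_nnnorm, hn]
  field_simp

lemma hoeffding_two {S : Type} [MeasurableSpace S] (μ : Measure S) [IsProbabilityMeasure μ]
    (f : S → ℝ) (hf : Measurable f) {R : ℝ} (hR : 0 < R) (hfR : ∀ s, |f s| ≤ R) (m : ℕ) (hm : 0 < m)
    {t : ℝ} (ht : 0 ≤ t) :
    (Measure.pi fun _ : Fin m => μ) {ω | t ≤ |(∑ i, f (ω i)) / m - ∫ s, f s ∂μ|} ≤
      ENNReal.ofReal (2 * Real.exp (-(m * t ^ 2 / (2 * R ^ 2)))) := by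
  have h1 := hoeffding_one μ f hf hR hfR m hm ht
  have h2 := hoeffding_one μ (fun s => - f s) hf.neg hR (by simpa using hfR) m hm ht
  have hm' : (0 : ℝ) < m := by exact_mod_cast hm
  rw [← ofReal_measureReal]
  refine ENNReal.ofReal_le_ofReal ?_
  refine (measureReal_mono (fun ω hω => ?_)).trans ((measureReal_union_le _ _).trans
    ((add_le_add h1 h2).trans (by linarith)))
  simp only [Set.mem_ofPred_eq, Set.mem_union, Finset.sum_sub_distrib, Finset.sum_const,
    Finset.card_univ, Fintype.card_fin, nsmul_eq_mul, Finset.sum_neg_distrib,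
    integral_neg] at hω ⊢
  rcases le_abs.1 hω with h | h
  · left
    have := mul_le_mul_of_nonneg_right h hm'.le
    rw [sub_mul, div_mul_cancel₀ _ hm'.ne'] at this
    linarith
  · right
    have := mul_le_mul_of_nonneg_right h hm'.le
    rw [neg_mul, sub_mul, div_mul_cancel₀ _ hm'.ne'] at this
    linarith

lemma integral_uniform_bool {n : ℕ} (f : (Fin n → Bool) → ℝ) :
    ∫ s, f s ∂(PMF.uniformOfFintype (Fin n → Bool)).toMeasure = (∑ s, f s) / 2 ^ n := by
  rw [PMF.integral_eq_sum, Finset.sum_div]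
  refine Finset.sum_congr rfl fun s _ => ?_
  simp
  ring

theorem ntk_random_features_exist :
    ∃ C : ℝ, 0 < C ∧
      ∀ (d L : ℕ), 1 ≤ d → 2 ≤ L →
        ∀ ε δ : ℝ, ε ∈ Set.Ioo (0 : ℝ) 1 → δ ∈ Set.Ioo (0 : ℝ) 1 →
          ∃ m : ℕ,
            (m : ℝ) ≤ C * ((L : ℝ) ^ 6 / ε ^ 4 * Real.log ((L : ℝ) / δ) +
              (L : ℝ) ^ 2 / ε ^ 2 * (Real.log ((L : ℝ) / (ε * δ))) ^ 3) ∧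
            ∃ (Ω : Type) (_ : MeasurableSpace Ω) (P : Measure Ω),
              IsProbabilityMeasure P ∧
              ∃ Ψ : Ω → EuclideanSpace ℝ (Fin d) → EuclideanSpace ℝ (Fin m),
                ∀ y z : EuclideanSpace ℝ (Fin d), y ≠ 0 → z ≠ 0 →
                  P {ω | ε * ThetaNTK d L y z <
                      |(inner ℝ (Ψ ω y) (Ψ ω z) : ℝ) - ThetaNTK d L y z|} ≤
                    ENNReal.ofReal δ := by
  refine ⟨2 * 10 ^ 11, by norm_num, ?_⟩
  intro d L _ hL ε δ hε hδ
  obtain ⟨hε0, hε1⟩ := hε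
  obtain ⟨hδ0, hδ1⟩ := hδ
  have hL2 : (2 : ℝ) ≤ L := by exact_mod_cast hL
  set R : ℝ := 600 * (L + 2) ^ 2 / ε with hR
  have hR0 : 0 < R := by positivity
  set M : ℝ := 2 * R ^ 2 * 10 ^ 4 / ε ^ 2 * Real.log (2 / δ) with hM
  have hlog2 : 0 < Real.log (2 / δ) := Real.log_pos (by rw [lt_div_iff₀ hδ0]; linarith)
  have hM0 : 0 < M := by positivity
  set m : ℕ := ⌈M⌉₊ with hm
  have hm0 : 0 < m := Nat.ceil_pos.2 hM0
  have hmM : M ≤ m := Nat.le_ceil M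
  have hm' : (0 : ℝ) < m := by exact_mod_cast hm0
  refine ⟨m, ?_, ?_⟩
  · -- the size bound
    have hlogL : Real.log (2 / δ) ≤ Real.log (L / δ) :=
      Real.log_le_log (by positivity) (by gcongr)
    have hhalf : 1 / 2 ≤ Real.log (L / δ) := by
      refine le_trans ?_ hlogL
      have : Real.log 2 ≤ Real.log (2 / δ) := Real.log_le_log (by norm_num) (by
        rw [le_div_iff₀ hδ0]; linarith)
      linarith [Real.log_two_gt_d9]
    have hlog3 : 0 ≤ Real.log (L / (ε * δ)) := by
      refine Real.log_nonneg ?_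
      rw [le_div_iff₀ (by positivity)]
      nlinarith
    have hsecond : 0 ≤ (L : ℝ) ^ 2 / ε ^ 2 * (Real.log ((L : ℝ) / (ε * δ))) ^ 3 := by positivity
    have hceil : (m : ℝ) ≤ M + 1 := (Nat.ceil_lt_add_one hM0.le).le
    have hMeq : M = 7200000000 * ((L + 2) ^ 4 / ε ^ 4 * Real.log (2 / δ)) := by
      rw [hM, hR]
      field_simp
      ring
    have hL4 : ((L : ℝ) + 2) ^ 4 ≤ 16 * L ^ 6 := by
      have h1 : ((L : ℝ) + 2) ^ 4 ≤ (2 * L) ^ 4 := by gcongr; linarith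
      have h2 : (L : ℝ) ^ 4 ≤ L ^ 6 := pow_le_pow_right₀ (by linarith) (by norm_num)
      calc _ ≤ (2 * (L : ℝ)) ^ 4 := h1
        _ = 16 * L ^ 4 := by ring
        _ ≤ _ := by linarith
    have hMle : M ≤ 7200000000 * (16 * L ^ 6 / ε ^ 4 * Real.log (L / δ)) := by
      rw [hMeq]
      gcongr
    have hbig : 1 ≤ (L : ℝ) ^ 6 / ε ^ 4 := by
      rw [le_div_iff₀ (by positivity)]
      have h1 : ε ^ 4 ≤ 1 := pow_le_one₀ hε0.le hε1.le
      have h2 : (1 : ℝ) ≤ L ^ 6 := one_le_pow₀ (by linarith)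
      linarith
    have hX : 1 / 2 ≤ (L : ℝ) ^ 6 / ε ^ 4 * Real.log (L / δ) := by nlinarith
    have e : 7200000000 * (16 * (L : ℝ) ^ 6 / ε ^ 4 * Real.log (L / δ)) =
      115200000000 * ((L : ℝ) ^ 6 / ε ^ 4 * Real.log (L / δ)) := by ring
    rw [e] at hMle
    linarith
  -- the polynomial approximation and its features
  obtain ⟨p, hp⟩ := nnApprox_K L (ε / 100) (by positivity)
  obtain ⟨ι, _, φ, hφ⟩ := exists_feature (E := EuclideanSpace ℝ (Fin d)) (d := d)
    (fun y i => y i) (fun y z => by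
      simp [PiLp.inner_apply, mul_comm]) p
  let n := Fintype.card ι
  let u : EuclideanSpace ℝ (Fin d) → Fin n → ℝ :=
    fun y k => φ (‖y‖⁻¹ • y) ((Fintype.equivFin ι).symm k)
  have hu : ∀ y z, ∑ k, u y k * u z k =
      Polynomial.aeval (inner ℝ (‖y‖⁻¹ • y) (‖z‖⁻¹ • z) : ℝ) p := fun y z => by
    rw [hφ]
    exact (Fintype.equivFin ι).symm.sum_comp
      (fun i => φ (‖y‖⁻¹ • y) i * φ (‖z‖⁻¹ • z) i)
  set B : ℝ := Polynomial.aeval (1 : ℝ) p with hB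
  have hBle : |B| ≤ L + 2 := by
    have h1 := hp 1 (by simp)
    have h2 := abs_K_le L (x := 1) (by simp)
    have h3 := abs_sub_abs_le_abs_sub B (KRelu L 1)
    rw [abs_sub_comm B] at h3
    linarith
  have huB : ∀ y, y ≠ 0 → ∑ k, u y k * u y k = B := fun y hy => by
    rw [hu, hB, real_inner_self_eq_norm_sq, norm_smul, norm_inv, norm_norm,
      inv_mul_cancel₀ (norm_ne_zero_iff.2 hy), one_pow]
  let T : ℝ := √R
  have hT0 : 0 < T := Real.sqrt_pos.2 hR0
  have hT2 : T ^ 2 = R := Real.sq_sqrt hR0.le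
  let μ : Measure (Fin n → Bool) := (PMF.uniformOfFintype (Fin n → Bool)).toMeasure
  refine ⟨Fin m → Fin n → Bool, inferInstance, Measure.pi fun _ => μ, inferInstance,
    fun ω y => WithLp.toLp 2 fun i => ‖y‖ * clip T (rad (u y) (ω i)) / √m, ?_⟩
  intro y z hy hz
  have hny : 0 < ‖y‖ := norm_pos_iff.2 hy
  have hnz : 0 < ‖z‖ := norm_pos_iff.2 hz
  set α : ℝ := (inner ℝ y z : ℝ) / (‖y‖ * ‖z‖) with hα
  have hαmem : α ∈ Set.Icc (-1 : ℝ) 1 := abs_le.1 (abs_real_inner_div_norm_mul_norm_le_one y z)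
  have hαeq : (inner ℝ (‖y‖⁻¹ • y) (‖z‖⁻¹ • z) : ℝ) = α := by
    rw [real_inner_smul_left, real_inner_smul_right, hα]
    field_simp
  let f : (Fin n → Bool) → ℝ := fun s => clip T (rad (u y) s) * clip T (rad (u z) s)
  have hfR : ∀ s, |f s| ≤ R := fun s => by
    rw [abs_mul, ← hT2, sq]
    exact mul_le_mul (abs_clip_le hT0.le _) (abs_clip_le hT0.le _) (abs_nonneg _) hT0.le
  have hmean : |∫ s, f s ∂μ - Polynomial.aeval α p| ≤ ε / 100 := by
    have h1 := clip_mean_error hT0 (u y) (u z) (huB y hy) (huB z hz)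
    rw [hu, hαeq] at h1
    rw [show ∫ s, f s ∂μ = (∑ s, f s) / 2 ^ n from integral_uniform_bool f]
    refine h1.trans ?_
    rw [hT2, div_le_iff₀ hR0, hR]
    have : B ^ 2 ≤ (L + 2 : ℝ) ^ 2 := sq_le_sq' (abs_le.1 hBle).1 (abs_le.1 hBle).2
    have e : ε / 100 * (600 * ((L : ℝ) + 2) ^ 2 / ε) = 6 * (L + 2) ^ 2 := by
      field_simp
      norm_num
    rw [e]
    linarith
  have hH := hoeffding_two μ f (measurable_of_finite f) hR0 hfR m hm0 (t := ε / 100) (by positivity)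
  refine (measure_mono ?_).trans (hH.trans (ENNReal.ofReal_le_ofReal ?_))
  · intro ω hω
    simp only [Set.mem_ofPred_eq] at hω ⊢
    have hin : (inner ℝ (WithLp.toLp 2 fun i => ‖y‖ * clip T (rad (u y) (ω i)) / √m :
          EuclideanSpace ℝ (Fin m))
        (WithLp.toLp 2 fun i => ‖z‖ * clip T (rad (u z) (ω i)) / √m) : ℝ) =
        ‖y‖ * ‖z‖ * ((∑ i, f (ω i)) / m) := by
      rw [PiLp.inner_apply, Finset.sum_div, Finset.mul_sum]
      refine Finset.sum_congr rfl fun i _ => ?_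
      have hs : √(m : ℝ) * √(m : ℝ) = m := Real.mul_self_sqrt hm'.le
      simp only [RCLike.inner_apply, conj_trivial, f]
      rw [div_mul_div_comm, hs]
      ring
    rw [hin, ThetaNTK, ← hα, ← mul_sub, abs_mul, abs_of_pos (mul_pos hny hnz),
      show ε * (‖y‖ * ‖z‖ * KRelu L α) = ‖y‖ * ‖z‖ * (ε * KRelu L α) by ring] at hω
    have hω' := lt_of_mul_lt_mul_left hω (mul_pos hny hnz).le
    have hK := K_ge hL hαmem
    have hpα := hp α hαmem
    have h1 : ε * (1 / 25) ≤ ε * KRelu L α := by gcongr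
    set a := (∑ i, f (ω i)) / (m : ℝ)
    have h2 := abs_add_le (a - ∫ s, f s ∂μ) (∫ s, f s ∂μ - Polynomial.aeval α p)
    have h3 := abs_add_le (a - Polynomial.aeval α p) (Polynomial.aeval α p - KRelu L α)
    rw [sub_add_sub_cancel] at h2 h3
    rw [abs_sub_comm] at hpα
    linarith
  · have h1 : Real.log (2 / δ) ≤ m * (ε / 100) ^ 2 / (2 * R ^ 2) := by
      rw [le_div_iff₀ (by positivity)]
      have h2 : M * (ε / 100) ^ 2 ≤ m * (ε / 100) ^ 2 := by gcongr
      refine le_trans (le_of_eq ?_) h2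
      rw [hM]
      field_simp
      norm_num
    have h2 : Real.exp (-(m * (ε / 100) ^ 2 / (2 * R ^ 2))) ≤ Real.exp (-Real.log (2 / δ)) :=
      Real.exp_le_exp.2 (by linarith)
    rw [Real.exp_neg (Real.log _), Real.exp_log (by positivity), inv_div] at h2
    linarith
end
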